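/- The kissing number in dimension 24 is 196560: for every finite set S of points in Euclidean 24-space ℝ²⁴ such that every point of S has norm 2 and any two distinct points of S are at distance at least 2 from each other, the cardinality of S is at most 196560; moreover, there exists such a set S with exactly 196560 points (as realized by the minimal vectors of the Leech lattice). -/

import Mathlib

open MvPolynomial in
/-- The Fischer (apolar) inner product on real polynomials, for which distinct monomials are
orthogonal and the monomial of exponent `m` has square norm `∏ i, (m i)!`. -/
noncomputable def fischer (σ : Type*) [Fintype σ] :
    MvPolynomial σ ℝ →ₗ[ℝ] MvPolynomial σ ℝ →ₗ[ℝ] ℝ :=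
  (basisMonomials σ ℝ).constr ℝ fun m => (∏ i, ((m i).factorial : ℝ)) • lcoeff ℝ m

section Fischer

open MvPolynomial

variable {σ : Type*}

lemma C_two : (C 2 : MvPolynomial σ ℝ) = 2 := map_ofNat C 2

lemma C_four : (C 4 : MvPolynomial σ ℝ) = 4 := map_ofNat C 4

variable [Fintype σ]

lemma fischer_monomial (m : σ →₀ ℕ) (c : ℝ) (q : MvPolynomial σ ℝ) :
    fischer σ (monomial m c) q = (∏ i, ((m i).factorial : ℝ)) * c * coeff m q := by
  have h : fischer σ (monomial m 1) = (∏ i, ((m i).factorial : ℝ)) • lcoeff ℝ m := by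
    have := (basisMonomials σ ℝ).constr_basis ℝ
      (fun m => (∏ i, ((m i).factorial : ℝ)) • lcoeff ℝ m) m
    simpa [fischer] using this
  have h2 : monomial m c = c • (monomial m 1 : MvPolynomial σ ℝ) := by simp [smul_monomial]
  rw [h2, map_smul, h]
  simp
  ring

lemma fischer_self_nonneg (p : MvPolynomial σ ℝ) : 0 ≤ fischer σ p p := by
  have h : fischer σ p p = ∑ m ∈ p.support, fischer σ (monomial m (coeff m p)) p := by
    rw [← LinearMap.sum_apply, ← map_sum, ← p.as_sum]
  rw [h]
  refine Finset.sum_nonneg fun m _ => ?_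
  rw [fischer_monomial, mul_assoc]
  exact mul_nonneg (by positivity) (mul_self_nonneg _)

lemma fischer_X_mul (i : σ) (p q : MvPolynomial σ ℝ) :
    fischer σ (X i * p) q = fischer σ p (pderiv i q) := by
  classical
  induction p using MvPolynomial.induction_on' with
  | add p q hp hq => simp only [mul_add, map_add, LinearMap.add_apply, hp, hq]
  | monomial m c =>
    have : (X i * monomial m c : MvPolynomial σ ℝ) = monomial (m + Finsupp.single i 1) c := by
      rw [X, monomial_mul, one_mul, add_comm]
    rw [this, fischer_monomial, fischer_monomial, coeff_pderiv]
    have hprod : ∏ j, (((m + Finsupp.single i 1 : σ →₀ ℕ) j).factorial : ℝ) =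
        (m i + 1) * ∏ j, ((m j).factorial : ℝ) := by
      rw [← Finset.mul_prod_erase _ _ (Finset.mem_univ i),
        ← Finset.mul_prod_erase _ (fun j => ((m j).factorial : ℝ)) (Finset.mem_univ i)]
      rw [Finset.prod_congr (g := fun j => ((m j).factorial : ℝ)) rfl]
      · simp [Nat.factorial_succ]
        ring
      · intro j hj
        simp [(Finset.ne_of_mem_erase hj).symm]
    rw [hprod]
    ring

/-- The Laplacian of a polynomial. -/
noncomputable def polyLaplacian (p : MvPolynomial σ ℝ) : MvPolynomial σ ℝ :=
  ∑ i, pderiv i (pderiv i p)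

/-- The squared radius as a polynomial. -/
noncomputable def radiusSq (σ : Type*) [Fintype σ] : MvPolynomial σ ℝ := ∑ i, X i ^ 2

/-- The linear form `z ↦ ⟨y, z⟩` as a polynomial. -/
noncomputable def linForm (y : σ → ℝ) : MvPolynomial σ ℝ := ∑ i, C (y i) * X i

lemma fischer_radiusSq_mul (p q : MvPolynomial σ ℝ) :
    fischer σ (radiusSq σ * p) q = fischer σ p (polyLaplacian q) := by
  simp only [radiusSq, polyLaplacian, Finset.sum_mul, map_sum, LinearMap.sum_apply, pow_two,
    mul_assoc, fischer_X_mul]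

lemma fischer_linForm_pow (y : σ → ℝ) (k : ℕ) (q : MvPolynomial σ ℝ) (hq : q.IsHomogeneous k) :
    fischer σ (linForm y ^ k) q = k.factorial * eval y q := by
  induction k generalizing q with
  | zero =>
    obtain ⟨c, rfl⟩ : ∃ c, q = C c :=
      ⟨_, totalDegree_eq_zero_iff_eq_C.1 (Nat.le_zero.1 hq.totalDegree_le)⟩
    have := fischer_monomial (σ := σ) 0 1 (C c)
    simpa using this
  | succ k ih =>
    have h1 : fischer σ (linForm y ^ (k + 1)) q =
        ∑ i, y i * fischer σ (linForm y ^ k) (pderiv i q) := by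
      rw [pow_succ']
      generalize linForm y ^ k = p
      simp only [linForm, Finset.sum_mul, map_sum, LinearMap.sum_apply, ← smul_eq_C_mul,
        smul_mul_assoc, map_smul, LinearMap.smul_apply, fischer_X_mul, smul_eq_mul]
    have h2 := congrArg (eval y) hq.sum_X_mul_pderiv
    simp only [map_sum, map_mul, eval_X, nsmul_eq_mul, map_natCast] at h2
    rw [h1, Finset.sum_congr rfl fun i _ => by rw [ih _ (by simpa using hq.pderiv (i := i))],
      Nat.factorial_succ]
    have : ∑ i, y i * (k.factorial * eval y (pderiv i q)) =
      k.factorial * ∑ i, y i * eval y (pderiv i q) := by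
      rw [Finset.mul_sum]; exact Finset.sum_congr rfl fun i _ => by ring
    rw [this, h2]
    push_cast
    ring

lemma polyLaplacian_mul (f g : MvPolynomial σ ℝ) :
    polyLaplacian (f * g) = polyLaplacian f * g + f * polyLaplacian g +
      2 * ∑ i, pderiv i f * pderiv i g := by
  simp only [polyLaplacian, pderiv_mul, map_add, Finset.sum_add_distrib, Finset.sum_mul,
    Finset.mul_sum, two_mul]
  ring

lemma pderiv_linForm (y : σ → ℝ) (i : σ) : pderiv i (linForm y) = C (y i) := by
  classical
  simp [linForm, pderiv_X, Pi.single_apply]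

lemma pderiv_radiusSq (i : σ) : pderiv i (radiusSq σ) = C 2 * X i := by
  classical
  simp [radiusSq, pderiv_X, Pi.single_apply, C_two]

lemma polyLaplacian_linForm_pow {y : σ → ℝ} (hy : ∑ i, y i ^ 2 = 1) (m : ℕ) :
    polyLaplacian (linForm y ^ m) = C ((m : ℝ) * (m - 1)) * linForm y ^ (m - 2) := by
  have hy' : ∑ i, (C (y i) : MvPolynomial σ ℝ) ^ 2 = 1 := by
    simp only [← map_pow, ← map_sum, hy, map_one]
  match m with
  | 0 => simp [polyLaplacian]
  | 1 => simp [polyLaplacian, pderiv_linForm]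
  | m + 2 =>
    have : ∀ i, pderiv i (pderiv i (linForm y ^ (m + 2))) =
        C (((m + 2 : ℕ) : ℝ) * ((m + 2 : ℕ) - 1)) * linForm y ^ m * C (y i) ^ 2 := by
      intro i
      rw [pderiv_pow, pderiv_linForm, pderiv_mul, pderiv_mul, pderiv_pow, pderiv_linForm, pderiv_C,
        ← C_eq_coe_nat, pderiv_C]
      simp [C_two]
      ring
    simp only [polyLaplacian, this, ← Finset.mul_sum, hy', mul_one, Nat.add_sub_cancel]

lemma polyLaplacian_radiusSq_pow (j : ℕ) :
    polyLaplacian (radiusSq σ ^ (j + 1)) =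
      C (2 * (j + 1) * (2 * j + Fintype.card σ) : ℝ) * radiusSq σ ^ j := by
  have h : ∀ i, pderiv i (pderiv i (radiusSq σ ^ (j + 1))) =
      C (2 * (j + 1) : ℝ) * radiusSq σ ^ j +
        C (4 * (j + 1) * j : ℝ) * radiusSq σ ^ (j - 1) * X i ^ 2 := by
    intro i
    rw [pderiv_pow, pderiv_radiusSq, pderiv_mul, pderiv_mul, pderiv_pow, pderiv_radiusSq,
      pderiv_mul, pderiv_C, ← C_eq_coe_nat, pderiv_C]
    simp [C_two, C_four]
    ring
  simp only [polyLaplacian, h, Finset.sum_add_distrib, ← Finset.mul_sum]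
  rw [← radiusSq]
  cases j with
  | zero => simp [C_two]
  | succ j => simp [C_two, C_four]; ring

lemma polyLaplacian_linForm_pow_mul_radiusSq_pow {y : σ → ℝ} (hy : ∑ i, y i ^ 2 = 1) (m j : ℕ) :
    polyLaplacian (linForm y ^ m * radiusSq σ ^ (j + 1)) =
      C ((m : ℝ) * (m - 1)) * (linForm y ^ (m - 2) * radiusSq σ ^ (j + 1)) +
      C (2 * (j + 1) * (2 * m + 2 * j + Fintype.card σ) : ℝ) *
        (linForm y ^ m * radiusSq σ ^ j) := by
  have hcross : ∑ i, pderiv i (linForm y ^ m) * pderiv i (radiusSq σ ^ (j + 1)) =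
      C (2 * (j + 1) * m : ℝ) * (linForm y ^ m * radiusSq σ ^ j) := by
    have h : ∀ i, pderiv i (linForm y ^ m) * pderiv i (radiusSq σ ^ (j + 1)) =
        C (2 * (j + 1) * m : ℝ) * (linForm y ^ (m - 1) * radiusSq σ ^ j) * (C (y i) * X i) := by
      intro i
      rw [pderiv_pow, pderiv_pow, pderiv_radiusSq, pderiv_linForm]
      simp [C_two]
      ring
    simp only [h, ← Finset.mul_sum]
    rw [← linForm]
    cases m with
    | zero => simp
    | succ m => simp; ring
  rw [polyLaplacian_mul, polyLaplacian_linForm_pow hy, polyLaplacian_radiusSq_pow, hcross]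
  simp [C_two]
  ring

/-- The coefficient of `t ^ (k - 2 * j)` in the monic Gegenbauer polynomial of degree `k` in
dimension `n`. -/
noncomputable def gegenbauerCoeff (n k : ℕ) : ℕ → ℝ
  | 0 => 1
  | j + 1 => -gegenbauerCoeff n k j * (((k - 2 * j : ℕ) : ℝ) * ((k - 2 * j : ℕ) - 1)) /
      (2 * (j + 1) * (2 * (k - 2 * (j + 1) : ℕ) + 2 * j + n))

/-- The monic Gegenbauer polynomial of degree `k` in dimension `n`. -/
noncomputable def gegenbauer (n k : ℕ) (t : ℝ) : ℝ :=
  ∑ j ∈ Finset.range (k / 2 + 1), gegenbauerCoeff n k j * t ^ (k - 2 * j)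

/-- The zonal harmonic polynomial of degree `k` with pole `y`. -/
noncomputable def zonal (y : σ → ℝ) (k : ℕ) : MvPolynomial σ ℝ :=
  ∑ j ∈ Finset.range (k / 2 + 1),
    C (gegenbauerCoeff (Fintype.card σ) k j) * (linForm y ^ (k - 2 * j) * radiusSq σ ^ j)

lemma polyLaplacian_add (p q : MvPolynomial σ ℝ) :
    polyLaplacian (p + q) = polyLaplacian p + polyLaplacian q := by
  simp [polyLaplacian, Finset.sum_add_distrib]

lemma polyLaplacian_C_mul (c : ℝ) (p : MvPolynomial σ ℝ) :
    polyLaplacian (C c * p) = C c * polyLaplacian p := by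
  simp [polyLaplacian, Finset.mul_sum]

lemma polyLaplacian_zonal [Nonempty σ] {y : σ → ℝ} (hy : ∑ i, y i ^ 2 = 1) (k : ℕ) :
    polyLaplacian (zonal y k) = 0 := by
  have key : ∀ J, 2 * J ≤ k → polyLaplacian (∑ j ∈ Finset.range (J + 1),
      C (gegenbauerCoeff (Fintype.card σ) k j) * (linForm y ^ (k - 2 * j) * radiusSq σ ^ j)) =
      C (gegenbauerCoeff (Fintype.card σ) k J * (((k - 2 * J : ℕ) : ℝ) * ((k - 2 * J : ℕ) - 1))) *
        (linForm y ^ (k - 2 * J - 2) * radiusSq σ ^ J) := by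
    intro J
    induction J with
    | zero =>
      intro _
      simp only [zero_add, Finset.sum_range_one, mul_zero, Nat.sub_zero, pow_zero, mul_one,
        polyLaplacian_linForm_pow hy, gegenbauerCoeff, one_mul, map_one]
    | succ J ih =>
      intro hJ
      have hcancel : gegenbauerCoeff (Fintype.card σ) k (J + 1) *
          (2 * (J + 1) * (2 * (k - 2 * (J + 1) : ℕ) + 2 * J + Fintype.card σ)) =
          -(gegenbauerCoeff (Fintype.card σ) k J *
            (((k - 2 * J : ℕ) : ℝ) * ((k - 2 * J : ℕ) - 1))) := by
        have : (0 : ℝ) < Fintype.card σ := by exact_mod_cast Fintype.card_pos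
        rw [gegenbauerCoeff, div_mul_cancel₀ _ (by positivity), neg_mul]
      rw [Finset.sum_range_succ, polyLaplacian_add, ih (by omega), polyLaplacian_C_mul,
        polyLaplacian_linForm_pow_mul_radiusSq_pow hy, mul_add, ← mul_assoc (C _) (C _),
        ← mul_assoc (C _) (C _), ← map_mul, ← map_mul, hcancel,
        show k - 2 * J - 2 = k - 2 * (J + 1) by omega, map_neg]
      ring
  rw [zonal, key _ (by omega)]
  obtain h | h : k - 2 * (k / 2) = 0 ∨ k - 2 * (k / 2) = 1 := by omega
  all_goals simp [h]

lemma isHomogeneous_zonal (y : σ → ℝ) (k : ℕ) : (zonal y k).IsHomogeneous k := by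
  refine IsHomogeneous.sum _ _ _ fun j hj => IsHomogeneous.C_mul ?_ _
  have hl : (linForm y).IsHomogeneous 1 :=
    IsHomogeneous.sum _ _ _ fun i _ => (isHomogeneous_X ℝ i).C_mul _
  have hq : (radiusSq σ).IsHomogeneous 2 :=
    IsHomogeneous.sum _ _ _ fun i _ => isHomogeneous_X_pow i 2
  have := (hl.pow (k - 2 * j)).mul (hq.pow j)
  rwa [show 1 * (k - 2 * j) + 2 * j = k by have := Finset.mem_range.1 hj; omega] at this

lemma eval_zonal {x : σ → ℝ} (hx : ∑ i, x i ^ 2 = 1) (y : σ → ℝ) (k : ℕ) :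
    eval x (zonal y k) = gegenbauer (Fintype.card σ) k (∑ i, x i * y i) := by
  simp [zonal, gegenbauer, linForm, radiusSq, hx, mul_comm]

lemma fischer_zonal [Nonempty σ] {x y : σ → ℝ} (hx : ∑ i, x i ^ 2 = 1) (hy : ∑ i, y i ^ 2 = 1)
    (k : ℕ) : fischer σ (zonal x k) (zonal y k) =
      k.factorial * gegenbauer (Fintype.card σ) k (∑ i, x i * y i) := by
  rw [← eval_zonal hx, ← fischer_linForm_pow x k _ (isHomogeneous_zonal y k)]
  conv_lhs => rw [zonal]
  rw [Finset.sum_range_succ', map_add, map_sum, LinearMap.add_apply, LinearMap.sum_apply,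
    Finset.sum_eq_zero]
  · simp [gegenbauerCoeff]
  · intro j _
    rw [show C (gegenbauerCoeff (Fintype.card σ) k (j + 1)) *
        (linForm x ^ (k - 2 * (j + 1)) * radiusSq σ ^ (j + 1)) =
        radiusSq σ * (C (gegenbauerCoeff (Fintype.card σ) k (j + 1)) *
          (linForm x ^ (k - 2 * (j + 1)) * radiusSq σ ^ j)) by ring,
      fischer_radiusSq_mul, polyLaplacian_zonal hy, map_zero]

/-- Gegenbauer polynomials are positive definite functions on the sphere (Schoenberg). -/
theorem sum_gegenbauer_nonneg [Nonempty σ] {ι : Type*} (S : Finset ι) (u : ι → σ → ℝ)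
    (hu : ∀ a ∈ S, ∑ i, u a i ^ 2 = 1) (k : ℕ) :
    0 ≤ ∑ a ∈ S, ∑ b ∈ S, gegenbauer (Fintype.card σ) k (∑ i, u a i * u b i) := by
  have h := fischer_self_nonneg (∑ a ∈ S, zonal (u a) k)
  have h2 : fischer σ (∑ a ∈ S, zonal (u a) k) (∑ a ∈ S, zonal (u a) k) =
      k.factorial * ∑ a ∈ S, ∑ b ∈ S, gegenbauer (Fintype.card σ) k (∑ i, u a i * u b i) := by
    simp only [map_sum, LinearMap.sum_apply, Finset.mul_sum]
    rw [Finset.sum_comm]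
    exact Finset.sum_congr rfl fun a ha => Finset.sum_congr rfl fun b hb =>
      fischer_zonal (hu a ha) (hu b hb) k
  rw [h2] at h
  exact nonneg_of_mul_nonneg_right h (by positivity)

end Fischer

section UpperBound

/-- The Levenshtein and Odlyzko–Sloane polynomial for the kissing problem in dimension 24. -/
noncomputable def levenshteinPoly (t : ℝ) : ℝ :=
  (t + 1) * (t + 1 / 2) ^ 2 * (t + 1 / 4) ^ 2 * t ^ 2 * (t - 1 / 4) ^ 2 * (t - 1 / 2)

lemma levenshteinPoly_nonpos {t : ℝ} (h1 : -1 ≤ t) (h2 : t ≤ 1 / 2) : levenshteinPoly t ≤ 0 :=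
  mul_nonpos_of_nonneg_of_nonpos
    (by have : 0 ≤ t + 1 := by linarith
        positivity) (by linarith)

lemma levenshteinPoly_eq (t : ℝ) : levenshteinPoly t =
    15 / 1490944 + 45 / 186368 * gegenbauer 24 1 t + 495 / 243712 * gegenbauer 24 2 t +
    435 / 34816 * gegenbauer 24 3 t + 6927 / 139264 * gegenbauer 24 4 t +
    1467 / 8704 * gegenbauer 24 5 t + 17747 / 43776 * gegenbauer 24 6 t +
    261 / 304 * gegenbauer 24 7 t + 5 / 4 * gegenbauer 24 8 t + 3 / 2 * gegenbauer 24 9 t +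
    gegenbauer 24 10 t := by
  simp only [levenshteinPoly, gegenbauer, gegenbauerCoeff, Finset.sum_range_succ,
    Finset.sum_range_zero, Nat.reduceDiv, Nat.reduceAdd, Nat.reduceMul, Nat.reduceSub]
  norm_num
  ring

theorem sum_levenshteinPoly_ge {ι : Type*} (S : Finset ι) (u : ι → Fin 24 → ℝ)
    (hu : ∀ a ∈ S, ∑ i, u a i ^ 2 = 1) :
    (S.card : ℝ) ^ 2 * (15 / 1490944) ≤
      ∑ a ∈ S, ∑ b ∈ S, levenshteinPoly (∑ i, u a i * u b i) := by
  have h := sum_gegenbauer_nonneg S u hu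
  simp only [Fintype.card_fin] at h
  simp only [levenshteinPoly_eq, Finset.sum_add_distrib, ← Finset.mul_sum, Finset.sum_const,
    nsmul_eq_mul]
  linarith [h 1, h 2, h 3, h 4, h 5, h 6, h 7, h 8, h 9, h 10]

theorem card_le_of_kissing (S : Finset (EuclideanSpace ℝ (Fin 24))) (hS : ∀ x ∈ S, ‖x‖ = 2)
    (hd : ∀ x ∈ S, ∀ y ∈ S, x ≠ y → 2 ≤ dist x y) : S.card ≤ 196560 := by
  have hsq : ∀ x ∈ S, ∑ i, x i ^ 2 = 4 := fun x hx => by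
    rw [← EuclideanSpace.real_norm_sq_eq, hS x hx]; norm_num
  have hu : ∀ x ∈ S, ∑ i, (x i / 2) ^ 2 = 1 := fun x hx => by
    simp only [div_pow, ← Finset.sum_div, hsq x hx]; norm_num
  have hlow := sum_levenshteinPoly_ge S (fun x i => x i / 2) hu
  have hrow : ∀ x ∈ S, ∑ y ∈ S, levenshteinPoly (∑ i, x i / 2 * (y i / 2)) ≤
      levenshteinPoly 1 := by
    intro x hx
    classical
    rw [← Finset.add_sum_erase _ _ hx]
    have h1 : ∑ i, x i / 2 * (x i / 2) = 1 := by simpa [pow_two] using hu x hx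
    rw [h1]
    refine add_le_of_nonpos_right (Finset.sum_nonpos fun y hy => ?_)
    obtain ⟨hne, hy⟩ := Finset.mem_erase.1 hy
    have hplus : 0 ≤ ∑ i, (x i + y i) ^ 2 := Finset.sum_nonneg fun i _ => sq_nonneg _
    have hminus : 4 ≤ ∑ i, (x i - y i) ^ 2 := by
      have := hd x hx y hy hne.symm
      rw [dist_eq_norm] at this
      have h2 := EuclideanSpace.real_norm_sq_eq (x - y)
      simp only [PiLp.sub_apply] at h2
      rw [← h2]
      nlinarith
    have hip : ∑ i, x i / 2 * (y i / 2) = (∑ i, x i * y i) / 4 := by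
      rw [Finset.sum_div]; exact Finset.sum_congr rfl fun i _ => by ring
    have e1 : ∑ i, (x i + y i) ^ 2 = ∑ i, x i ^ 2 + ∑ i, y i ^ 2 + 2 * ∑ i, x i * y i := by
      simp only [Finset.mul_sum, ← Finset.sum_add_distrib]
      exact Finset.sum_congr rfl fun i _ => by ring
    have e2 : ∑ i, (x i - y i) ^ 2 = ∑ i, x i ^ 2 + ∑ i, y i ^ 2 - 2 * ∑ i, x i * y i := by
      simp only [Finset.mul_sum, ← Finset.sum_add_distrib, ← Finset.sum_sub_distrib]
      exact Finset.sum_congr rfl fun i _ => by ring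
    rw [hsq x hx, hsq y hy] at e1 e2
    exact levenshteinPoly_nonpos (by linarith) (by linarith)
  have hup := Finset.sum_le_card_nsmul S _ _ hrow
  rw [nsmul_eq_mul] at hup
  have hval : levenshteinPoly 1 = 196560 * (15 / 1490944) := by norm_num [levenshteinPoly]
  rw [hval] at hup
  rcases Nat.eq_zero_or_pos S.card with h0 | h0
  · omega
  · have h0' : (0 : ℝ) < S.card := by exact_mod_cast h0
    have : (S.card : ℝ) ≤ 196560 := by nlinarith [hlow.trans hup]
    exact_mod_cast this

end UpperBound

section Golay

/-- The list of all sums (bitwise exclusive or) of sublists of a list of bit vectors. -/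
def xorSpan : List ℕ → List ℕ
  | [] => [0]
  | g :: gs => xorSpan gs ++ (xorSpan gs).map (g ^^^ ·)

/-- The number of elements of the coset `c ^^^ xorSpan gs` that satisfy `p`. -/
def xorSpanCount (p : ℕ → Bool) : List ℕ → ℕ → ℕ
  | [], c => bif p c then 1 else 0
  | g :: gs, c => xorSpanCount p gs c + xorSpanCount p gs (c ^^^ g)

lemma mem_xorSpan_cons {g : ℕ} {gs : List ℕ} {c : ℕ} :
    c ∈ xorSpan (g :: gs) ↔ c ∈ xorSpan gs ∨ g ^^^ c ∈ xorSpan gs := by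
  simp only [xorSpan, List.mem_append, List.mem_map]
  refine or_congr_right ⟨?_, fun h => ⟨_, h, ?_⟩⟩
  · rintro ⟨d, hd, rfl⟩
    simpa [← Nat.xor_assoc] using hd
  · simp

lemma zero_mem_xorSpan (gs : List ℕ) : 0 ∈ xorSpan gs := by
  induction gs with
  | nil => simp [xorSpan]
  | cons g gs ih => exact mem_xorSpan_cons.2 (.inl ih)

lemma xor_mem_xorSpan {gs : List ℕ} {c d : ℕ} (hc : c ∈ xorSpan gs) (hd : d ∈ xorSpan gs) :
    c ^^^ d ∈ xorSpan gs := by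
  induction gs generalizing c d with
  | nil => simp_all [xorSpan]
  | cons g gs ih =>
    rw [mem_xorSpan_cons] at *
    rcases hc with hc | hc <;> rcases hd with hd | hd
    · exact .inl (ih hc hd)
    · exact .inr (by simpa [Nat.xor_left_comm] using ih hc hd)
    · exact .inr (by simpa [Nat.xor_assoc] using ih hc hd)
    · refine .inl ?_
      have := ih hc hd
      rwa [Nat.xor_comm g c, Nat.xor_assoc, ← Nat.xor_assoc g g d, Nat.xor_self,
        Nat.zero_xor] at this

lemma lt_of_mem_xorSpan {gs : List ℕ} {n : ℕ} (h : ∀ g ∈ gs, g < 2 ^ n) {c : ℕ}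
    (hc : c ∈ xorSpan gs) : c < 2 ^ n := by
  induction gs generalizing c with
  | nil => simp_all [xorSpan]
  | cons g gs ih =>
    simp only [List.mem_cons, forall_eq_or_imp] at h
    rcases mem_xorSpan_cons.1 hc with hc | hc
    · exact ih h.2 hc
    · have := Nat.xor_lt_two_pow h.1 (ih h.2 hc)
      rwa [← Nat.xor_assoc, Nat.xor_self, Nat.zero_xor] at this

lemma length_xorSpan (gs : List ℕ) : (xorSpan gs).length = 2 ^ gs.length := by
  induction gs with
  | nil => simp [xorSpan]
  | cons g gs ih => simp [xorSpan, ih]; ring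

lemma nodup_xorSpan {gs : List ℕ} (h0 : 0 ∉ gs) (h : gs.Pairwise fun g h => h < 2 ^ g.log2) :
    (xorSpan gs).Nodup := by
  induction gs with
  | nil => simp [xorSpan]
  | cons g gs ih =>
    rw [List.pairwise_cons] at h
    simp only [List.mem_cons, not_or] at h0
    have hnd := ih h0.2 h.2
    refine hnd.append (hnd.map (Nat.xor_right_injective)) fun c hc hc' => ?_
    obtain ⟨d, hd, rfl⟩ := List.mem_map.1 hc'
    have hg : g ^^^ d ^^^ d ∈ xorSpan gs := xor_mem_xorSpan hc hd
    rw [Nat.xor_assoc, Nat.xor_self, Nat.xor_zero] at hg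
    exact absurd (lt_of_mem_xorSpan h.1 hg) (not_lt.2 (Nat.log2_self_le (Ne.symm h0.1)))

lemma xorSpanCount_eq (p : ℕ → Bool) (gs : List ℕ) (c : ℕ) :
    xorSpanCount p gs c = (xorSpan gs).countP fun d => p (c ^^^ d) := by
  induction gs generalizing c with
  | nil => cases h : p c <;> simp [xorSpan, xorSpanCount, h]
  | cons g gs ih =>
    simp [xorSpan, xorSpanCount, ih, List.countP_append, List.countP_map, Function.comp_def,
      Nat.xor_assoc]

/-- The number of nonzero bits among the lowest `n` bits of `c`. -/
def bitWeight : ℕ → ℕ → ℕ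
  | 0, _ => 0
  | n + 1, c => c / 2 ^ n % 2 + bitWeight n c

/-- The set of nonzero bits of a 24-bit vector. -/
def bitSupport (c : ℕ) : Finset (Fin 24) := Finset.univ.filter fun i => c.testBit i

lemma mem_bitSupport {c : ℕ} {i : Fin 24} : i ∈ bitSupport c ↔ c.testBit i = true := by
  simp [bitSupport]

lemma card_bitSupport (c : ℕ) : (bitSupport c).card = bitWeight 24 c := by
  have h : ∀ n, bitWeight n c = ∑ i ∈ Finset.range n, if c.testBit i then 1 else 0 := by
    intro n
    induction n with
    | zero => rfl
    | succ n ih =>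
      rw [bitWeight, Finset.sum_range_succ, ih, add_comm, Nat.testBit_eq_decide_div_mod_eq]
      rcases Nat.mod_two_eq_zero_or_one (c / 2 ^ n) with h | h <;> simp [h]
  rw [h, bitSupport, Finset.card_filter,
    Fin.sum_univ_eq_sum_range (fun i => if c.testBit i then 1 else 0)]

lemma bitSupport_xor (c d : ℕ) :
    bitSupport (c ^^^ d) = symmDiff (bitSupport c) (bitSupport d) := by
  ext i
  simp only [mem_bitSupport, Nat.testBit_xor, Finset.mem_symmDiff]
  cases c.testBit i <;> cases d.testBit i <;> simp

lemma bitSupport_injOn : Set.InjOn bitSupport {c | c < 2 ^ 24} := by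
  intro c hc d hd h
  refine Nat.eq_of_testBit_eq fun i => ?_
  by_cases hi : i < 24
  · have := Finset.ext_iff.1 h ⟨i, hi⟩
    simp only [mem_bitSupport] at this
    exact Bool.eq_iff_iff.2 this
  · have hle : 2 ^ 24 ≤ 2 ^ i := Nat.pow_le_pow_right (by norm_num) (not_lt.1 hi)
    rw [Nat.testBit_lt_two_pow (lt_of_lt_of_le hc hle),
      Nat.testBit_lt_two_pow (lt_of_lt_of_le hd hle)]

/-- The multiples `x ^ i * g` of the generator polynomial
`g = x ^ 11 + x ^ 10 + x ^ 6 + x ^ 5 + x ^ 4 + x ^ 2 + 1` of the cyclic binary Golay code, each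
extended by a parity bit in position zero. -/
def golayGenerators : List ℕ :=
  [13062145, 6531073, 3265537, 1632769, 816385, 408193, 204097, 102049, 51025, 25513, 12757, 6379]

/-- The extended binary Golay code, as a family of subsets of a 24-element set. -/
def golayCode : Finset (Finset (Fin 24)) := (xorSpan golayGenerators).toFinset.image bitSupport

lemma lt_of_mem_xorSpan_golayGenerators {c : ℕ} (hc : c ∈ xorSpan golayGenerators) :
    c < 2 ^ 24 :=
  lt_of_mem_xorSpan (by decide) hc

lemma nodup_xorSpan_golayGenerators : (xorSpan golayGenerators).Nodup :=
  nodup_xorSpan (by decide) (by decide +kernel)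

lemma bitSupport_injOn_golay :
    Set.InjOn bitSupport ((xorSpan golayGenerators).toFinset : Set ℕ) :=
  bitSupport_injOn.mono fun _ hc => lt_of_mem_xorSpan_golayGenerators (by simpa using hc)

lemma empty_mem_golayCode : ∅ ∈ golayCode :=
  Finset.mem_image.2 ⟨0, List.mem_toFinset.2 (zero_mem_xorSpan _), by simp [bitSupport]⟩

lemma symmDiff_mem_golayCode {s t : Finset (Fin 24)} (hs : s ∈ golayCode) (ht : t ∈ golayCode) :
    symmDiff s t ∈ golayCode := by
  simp only [golayCode, Finset.mem_image, List.mem_toFinset] at *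
  obtain ⟨c, hc, rfl⟩ := hs
  obtain ⟨d, hd, rfl⟩ := ht
  exact ⟨_, xor_mem_xorSpan hc hd, bitSupport_xor c d⟩

lemma card_golayCode : golayCode.card = 4096 := by
  rw [golayCode, Finset.card_image_of_injOn bitSupport_injOn_golay,
    List.toFinset_card_of_nodup nodup_xorSpan_golayGenerators, length_xorSpan]
  rfl

lemma countP_xorSpan_golayGenerators (p : ℕ → Bool) :
    (xorSpan golayGenerators).countP p = xorSpanCount p golayGenerators 0 := by
  simp [xorSpanCount_eq]

lemma card_of_mem_golayCode {s : Finset (Fin 24)} (hs : s ∈ golayCode) :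
    s.card = 0 ∨ s.card = 8 ∨ s.card = 12 ∨ s.card = 16 ∨ s.card = 24 := by
  have h : (xorSpan golayGenerators).countP
      (fun c => [0, 8, 12, 16, 24].contains (bitWeight 24 c)) =
      (xorSpan golayGenerators).length := by
    rw [countP_xorSpan_golayGenerators, length_xorSpan]
    decide +kernel
  simp only [golayCode, Finset.mem_image, List.mem_toFinset] at hs
  obtain ⟨c, hc, rfl⟩ := hs
  simpa [card_bitSupport] using List.countP_eq_length.1 h c hc

lemma card_golayCode_octads : (golayCode.filter fun s => s.card = 8).card = 759 := by
  have h : (xorSpan golayGenerators).countP (fun c => bitWeight 24 c == 8) = 759 := by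
    rw [countP_xorSpan_golayGenerators]
    decide +kernel
  rw [golayCode, Finset.filter_image,
    Finset.card_image_of_injOn (bitSupport_injOn_golay.mono
      (Finset.coe_subset.2 (Finset.filter_subset _ _))), ← h,
    List.countP_eq_length_filter,
    ← List.toFinset_card_of_nodup (nodup_xorSpan_golayGenerators.filter _), List.toFinset_filter]
  simp [card_bitSupport]

attribute [irreducible] golayCode

end Golay

section Leech

/-- The support of the reduction modulo 2 of an integer vector. -/
def oddSupport (a : Fin 24 → ℤ) : Finset (Fin 24) := Finset.univ.filter fun i => Odd (a i)

lemma mem_oddSupport {a : Fin 24 → ℤ} {i : Fin 24} : i ∈ oddSupport a ↔ Odd (a i) := by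
  simp [oddSupport]

/-- Membership in the Leech lattice, scaled by `√8`. -/
def IsLeech (v : Fin 24 → ℤ) : Prop :=
  ∃ (m : ℤ) (a : Fin 24 → ℤ), oddSupport a ∈ golayCode ∧ (∀ i, v i = m + 2 * a i) ∧
    (8 : ℤ) ∣ ∑ i, v i - 4 * m

lemma IsLeech.sub {v w : Fin 24 → ℤ} (hv : IsLeech v) (hw : IsLeech w) : IsLeech (v - w) := by
  obtain ⟨m, a, ha, hva, hvm⟩ := hv
  obtain ⟨n, b, hb, hwb, hwn⟩ := hw
  refine ⟨m - n, a - b, ?_, fun i => ?_, ?_⟩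
  · have : oddSupport (a - b) = symmDiff (oddSupport a) (oddSupport b) := by
      ext i
      simp only [mem_oddSupport, Finset.mem_symmDiff, Pi.sub_apply, Int.odd_sub,
        Int.not_odd_iff_even]
      grind
    exact this ▸ symmDiff_mem_golayCode ha hb
  · simp only [Pi.sub_apply, hva, hwb]; ring
  · have := dvd_sub hvm hwn
    rw [show ∑ i, (v - w) i - 4 * (m - n) = ∑ i, v i - 4 * m - (∑ i, w i - 4 * n) by
      simp only [Pi.sub_apply, Finset.sum_sub_distrib]; ring]
    exact this

lemma card_oddSupport_const_add {a : Fin 24 → ℤ} (ha : oddSupport a ∈ golayCode) (k : ℤ) :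
    (oddSupport fun i => k + a i).card = 0 ∨ (oddSupport fun i => k + a i).card = 8 ∨
      (oddSupport fun i => k + a i).card = 12 ∨ (oddSupport fun i => k + a i).card = 16 ∨
      (oddSupport fun i => k + a i).card = 24 := by
  have hw := card_of_mem_golayCode ha
  rcases Int.even_or_odd k with hk | hk
  · have : (oddSupport fun i => k + a i) = oddSupport a := by
      ext i; simp [mem_oddSupport, Int.odd_add', hk]
    rwa [this]
  · have : (oddSupport fun i => k + a i) = (oddSupport a)ᶜ := by
      ext i; simp [mem_oddSupport, Int.odd_add, hk]
    rw [this, Finset.card_compl, Fintype.card_fin]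
    omega

lemma card_oddSupport_le_sum_sq (u : Fin 24 → ℤ) : ((oddSupport u).card : ℤ) ≤ ∑ i, u i ^ 2 := by
  rw [oddSupport, Finset.card_filter]
  push_cast
  refine Finset.sum_le_sum fun i _ => ?_
  split_ifs with h
  · have : u i ≠ 0 := by rintro h0; simp [h0] at h
    have := Int.one_le_abs this
    nlinarith [sq_abs (u i)]
  · positivity

lemma even_sum_sq_sub (w : Fin 24 → ℤ) : Even (∑ i, w i ^ 2 - ∑ i, w i) := by
  rw [← Finset.sum_sub_distrib]
  refine Finset.even_sum _ fun i _ => ?_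
  rw [show w i ^ 2 - w i = (w i - 1) * (w i - 1 + 1) by ring]
  exact Int.even_mul_succ_self _

/-- Nonzero vectors of the even part of the (scaled) Leech lattice have square norm at least 32;
here `u` is half of such a vector. -/
lemma leech_even_min_norm {u : Fin 24 → ℤ} (hu : u ≠ 0)
    (hw : (oddSupport u).card = 0 ∨ 8 ≤ (oddSupport u).card) (hs : (4 : ℤ) ∣ ∑ i, u i) :
    8 ≤ ∑ i, u i ^ 2 := by
  rcases hw with hw | hw
  · have heven : ∀ i, ∃ t, u i = 2 * t := fun i => by
      rw [← even_iff_exists_two_mul, ← Int.not_odd_iff_even, ← mem_oddSupport,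
        Finset.card_eq_zero.1 hw]
      simp
    choose w hw using heven
    have hsq : ∑ i, u i ^ 2 = 4 * ∑ i, w i ^ 2 := by
      rw [Finset.mul_sum]; exact Finset.sum_congr rfl fun i _ => by rw [hw]; ring
    have hsum : ∑ i, u i = 2 * ∑ i, w i := by
      rw [Finset.mul_sum]; exact Finset.sum_congr rfl fun i _ => hw i
    have hpos : 0 < ∑ i, w i ^ 2 := by
      obtain ⟨i, hi⟩ := Function.ne_iff.1 hu
      refine Finset.sum_pos' (fun i _ => sq_nonneg _) ⟨i, Finset.mem_univ i, ?_⟩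
      have : w i ≠ 0 := by rintro h0; simp [hw, h0] at hi
      positivity
    obtain ⟨r, hr⟩ := even_sum_sq_sub w
    rw [hsum] at hs
    omega
  · have := card_oddSupport_le_sum_sq u
    omega

/-- Vectors of the odd part of the (scaled) Leech lattice, written as `2 * u + 1`, have square norm
at least 32. -/
lemma leech_odd_min_norm {u : Fin 24 → ℤ} (hw : 4 ∣ (oddSupport u).card)
    (hs : ¬ (8 : ℤ) ∣ ∑ i, (2 * u i + 1)) : 32 ≤ ∑ i, (2 * u i + 1) ^ 2 := by
  by_cases h : ∃ i, u i ≠ 0 ∧ u i ≠ -1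
  · obtain ⟨i, h0, h1⟩ := h
    rw [← Finset.add_sum_erase _ (fun j => (2 * u j + 1) ^ 2) (Finset.mem_univ i)]
    have hi : 9 ≤ (2 * u i + 1) ^ 2 := by
      rcases lt_or_gt_of_ne h0 with h | h
      · have : u i ≤ -2 := by omega
        nlinarith
      · nlinarith
    have hrest : ∑ j ∈ Finset.univ.erase i, (1 : ℤ) ≤
        ∑ j ∈ Finset.univ.erase i, (2 * u j + 1) ^ 2 := by
      refine Finset.sum_le_sum fun j _ => ?_
      rcases le_or_gt 0 (u j) with h | h <;> nlinarith
    simp only [Finset.sum_const, Finset.card_erase_of_mem (Finset.mem_univ i), Finset.card_univ,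
      Fintype.card_fin, nsmul_eq_mul, mul_one, Nat.reduceSub, Nat.cast_ofNat] at hrest
    linarith
  · push Not at h
    refine absurd ?_ hs
    have hval : ∀ i, 2 * u i + 1 = 1 - 2 * (if Odd (u i) then 1 else 0) := by
      intro i
      by_cases h0 : u i = 0
      · simp [h0]
      · simp [h i h0]
    simp only [hval, Finset.sum_sub_distrib, ← Finset.mul_sum]
    rw [Finset.sum_boole, ← oddSupport]
    simp
    omega

theorem IsLeech.min_norm {v : Fin 24 → ℤ} (hv : IsLeech v) (h0 : v ≠ 0) : 32 ≤ ∑ i, v i ^ 2 := by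
  obtain ⟨m, a, ha, hva, hvm⟩ := hv
  obtain ⟨k, rfl | rfl⟩ := Int.even_or_odd' m
  · have hvu : ∀ i, v i = 2 * (k + a i) := fun i => by rw [hva]; ring
    have hu : (fun i => k + a i) ≠ 0 := fun h => h0 <| funext fun i => by
      rw [hvu, show k + a i = 0 from congrFun h i]; rfl
    have hs : ∑ i, v i = 2 * ∑ i, (k + a i) := by
      rw [Finset.mul_sum]; exact Finset.sum_congr rfl fun i _ => hvu i
    have hsq : ∑ i, v i ^ 2 = 4 * ∑ i, (k + a i) ^ 2 := by
      rw [Finset.mul_sum]; exact Finset.sum_congr rfl fun i _ => by rw [hvu]; ring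
    have := leech_even_min_norm hu (by have := card_oddSupport_const_add ha k; omega)
      (by rw [hs] at hvm; omega)
    linarith
  · have hvu : ∀ i, v i = 2 * (k + a i) + 1 := fun i => by rw [hva]; ring
    simp only [hvu] at hvm ⊢
    exact leech_odd_min_norm (u := fun i => k + a i)
      (by have := card_oddSupport_const_add ha k; omega) (by omega)

/-- The vector supported on `D` whose entries are `-k` on `s ⊆ D` and `k` on `D \ s`. -/
def signedVec (k : ℤ) (D s : Finset (Fin 24)) (i : Fin 24) : ℤ :=
  if i ∈ D then if i ∈ s then -k else k else 0

/-- The vector with entries `-1` on `s` and `1` off `s`, except for the entry at `j`, which is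
multiplied by `-3`. -/
def oddVec (j : Fin 24) (s : Finset (Fin 24)) (i : Fin 24) : ℤ :=
  (if i ∈ s then -1 else 1) * if i = j then -3 else 1

lemma sum_sq_signedVec (k : ℤ) (D s : Finset (Fin 24)) :
    ∑ i, signedVec k D s i ^ 2 = k ^ 2 * D.card := by
  have : ∀ i, signedVec k D s i ^ 2 = if i ∈ D then k ^ 2 else 0 := fun i => by
    unfold signedVec; split_ifs <;> simp
  simp only [this, Finset.sum_ite_mem, Finset.univ_inter, Finset.sum_const, nsmul_eq_mul]
  ring

lemma sum_signedVec (k : ℤ) {D s : Finset (Fin 24)} (h : s ⊆ D) :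
    ∑ i, signedVec k D s i = k * (D.card - 2 * s.card) := by
  have : ∀ i, signedVec k D s i = (if i ∈ D then k else 0) - if i ∈ s then 2 * k else 0 := by
    intro i
    have := @h i
    unfold signedVec
    split_ifs <;> first | exact absurd (this ‹_›) ‹_› | ring
  simp only [this, Finset.sum_sub_distrib, Finset.sum_ite_mem, Finset.univ_inter,
    Finset.sum_const, nsmul_eq_mul]
  ring

lemma signedVec_injOn {k : ℤ} (hk : k ≠ 0) {D s D' s' : Finset (Fin 24)} (hs : s ⊆ D)
    (hs' : s' ⊆ D') (h : signedVec k D s = signedVec k D' s') : D = D' ∧ s = s' := by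
  have hkk : -k ≠ k := fun h => hk (by omega)
  have key : ∀ i, (i ∈ D ↔ i ∈ D') ∧ (i ∈ s ↔ i ∈ s') := by
    intro i
    have h1 := congrFun h i
    have h2 := @hs i
    have h3 := @hs' i
    unfold signedVec at h1
    grind
  exact ⟨Finset.ext fun i => (key i).1, Finset.ext fun i => (key i).2⟩

lemma sum_sq_oddVec (j : Fin 24) (s : Finset (Fin 24)) : ∑ i, oddVec j s i ^ 2 = 32 := by
  have : ∀ i, oddVec j s i ^ 2 = 1 + if i = j then 8 else 0 := fun i => by
    unfold oddVec; split_ifs <;> norm_num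
  simp [this, Finset.sum_add_distrib]

lemma sum_oddVec (j : Fin 24) (s : Finset (Fin 24)) :
    ∑ i, oddVec j s i = 24 - 2 * s.card + if j ∈ s then 4 else -4 := by
  have : ∀ i, oddVec j s i = 1 - (if i ∈ s then 2 else 0) +
      if i = j then (if j ∈ s then 4 else -4) else 0 := fun i => by
    unfold oddVec
    split_ifs <;> simp_all
  simp only [this, Finset.sum_add_distrib, Finset.sum_sub_distrib, Finset.sum_ite_mem,
    Finset.univ_inter, Finset.sum_const, Finset.sum_ite_eq', Finset.mem_univ, if_true]
  simp
  ring

lemma oddVec_injective {j j' : Fin 24} {s s' : Finset (Fin 24)} (h : oddVec j s = oddVec j' s') :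
    j = j' ∧ s = s' := by
  have hj : j = j' := by
    have h1 := congrFun h j
    unfold oddVec at h1
    by_contra hne
    split_ifs at h1 <;> simp_all
  subst hj
  refine ⟨rfl, Finset.ext fun i => ?_⟩
  have h1 := congrFun h i
  unfold oddVec at h1
  split_ifs at h1 <;> simp_all

lemma isLeech_signedVec_four {D s : Finset (Fin 24)} (hD : D.card = 2) (hs : s ⊆ D) :
    IsLeech (signedVec 4 D s) := by
  refine ⟨0, signedVec 2 D s, ?_, fun i => ?_, ?_⟩
  · have : oddSupport (signedVec 2 D s) = ∅ := by
      ext i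
      rw [mem_oddSupport, signedVec]
      split_ifs <;> simp
    exact this ▸ empty_mem_golayCode
  · unfold signedVec; split_ifs <;> norm_num
  · rw [sum_signedVec _ hs, hD]; push_cast; omega

lemma isLeech_signedVec_two {D s : Finset (Fin 24)} (hD : D ∈ golayCode) (hc : D.card = 8)
    (hs : s ⊆ D) (he : Even s.card) : IsLeech (signedVec 2 D s) := by
  refine ⟨0, signedVec 1 D s, ?_, fun i => ?_, ?_⟩
  · have : oddSupport (signedVec 1 D s) = D := by
      ext i
      rw [mem_oddSupport, signedVec]
      split_ifs <;> simp_all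
    rwa [this]
  · unfold signedVec; split_ifs <;> norm_num
  · obtain ⟨r, hr⟩ := he
    rw [sum_signedVec _ hs, hc, hr]; push_cast; omega

lemma isLeech_oddVec (j : Fin 24) {s : Finset (Fin 24)} (hs : s ∈ golayCode) :
    IsLeech (oddVec j s) := by
  refine ⟨1, fun i => if i = j then (if i ∈ s then 1 else -2) else if i ∈ s then -1 else 0,
    ?_, fun i => ?_, ?_⟩
  · convert hs
    ext i
    rw [mem_oddSupport]
    split_ifs <;> simp_all
  · beta_reduce; unfold oddVec; split_ifs <;> norm_num
  · have := card_of_mem_golayCode hs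
    rw [sum_oddVec]
    split_ifs <;> omega

lemma card_filter_even_powerset {α : Type*} [DecidableEq α] {D : Finset α} (hD : D.Nonempty) :
    2 * (D.powerset.filter fun s => Even s.card).card = 2 ^ D.card := by
  have h1 : ∀ s : Finset α, (1 : ℤ) + (-1) ^ s.card = 2 * if Even s.card then 1 else 0 := by
    intro s
    rcases Nat.even_or_odd s.card with h | h
    · simp [h, h.neg_one_pow]
    · simp [h.neg_one_pow, Nat.not_even_iff_odd.2 h]
  have h2 := Finset.sum_congr (rfl : D.powerset = D.powerset) fun s _ => h1 s
  rw [Finset.sum_add_distrib, Finset.sum_powerset_neg_one_pow_card_of_nonempty hD,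
    ← Finset.mul_sum, Finset.sum_boole] at h2
  simp only [Finset.sum_const, Finset.card_powerset, nsmul_eq_mul, mul_one, add_zero] at h2
  exact_mod_cast h2.symm

/-- The minimal vectors of shape `(±4², 0²²)`. -/
def minVecsFour : Finset (Fin 24 → ℤ) :=
  ((Finset.powersetCard 2 Finset.univ).sigma fun D => D.powerset).image fun p =>
    signedVec 4 p.1 p.2

/-- The minimal vectors of shape `(±2⁸, 0¹⁶)`. -/
def minVecsTwo : Finset (Fin 24 → ℤ) :=
  ((golayCode.filter fun D => D.card = 8).sigma fun D =>
    D.powerset.filter fun s => Even s.card).image fun p => signedVec 2 p.1 p.2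

/-- The minimal vectors of shape `(∓3, ±1²³)`. -/
def minVecsOdd : Finset (Fin 24 → ℤ) :=
  (Finset.univ ×ˢ golayCode).image fun p => oddVec p.1 p.2

attribute [irreducible] minVecsFour minVecsTwo minVecsOdd

lemma mem_minVecsFour {v : Fin 24 → ℤ} :
    v ∈ minVecsFour ↔ ∃ D s, D.card = 2 ∧ s ⊆ D ∧ signedVec 4 D s = v := by
  simp [minVecsFour, and_assoc]

lemma mem_minVecsTwo {v : Fin 24 → ℤ} : v ∈ minVecsTwo ↔
    ∃ D s, D ∈ golayCode ∧ D.card = 8 ∧ s ⊆ D ∧ Even s.card ∧ signedVec 2 D s = v := by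
  simp [minVecsTwo, and_assoc]

lemma mem_minVecsOdd {v : Fin 24 → ℤ} :
    v ∈ minVecsOdd ↔ ∃ j, ∃ s ∈ golayCode, oddVec j s = v := by
  simp [minVecsOdd]

lemma card_image_signedVec {k : ℤ} (hk : k ≠ 0) (F : Finset (Finset (Fin 24)))
    (P : Finset (Fin 24) → Finset (Finset (Fin 24))) (hP : ∀ D, ∀ s ∈ P D, s ⊆ D) :
    ((F.sigma P).image fun p => signedVec k p.1 p.2).card = ∑ D ∈ F, (P D).card := by
  rw [Finset.card_image_of_injOn, Finset.card_sigma]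
  rintro ⟨D, s⟩ h ⟨D', s'⟩ h' he
  simp only [Finset.coe_sigma, Set.mem_sigma_iff, Finset.mem_coe] at h h'
  obtain ⟨rfl, rfl⟩ := signedVec_injOn hk (hP _ _ h.2) (hP _ _ h'.2) he
  rfl

lemma card_minVecsFour : minVecsFour.card = 1104 := by
  rw [minVecsFour, card_image_signedVec (by norm_num) _ _ fun D s hs => Finset.mem_powerset.1 hs,
    Finset.sum_congr rfl (g := fun _ => 4)]
  · simp [Nat.choose]
  · intro D hD
    rw [Finset.card_powerset, (Finset.mem_powersetCard.1 hD).2]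
    rfl

lemma card_minVecsTwo : minVecsTwo.card = 97152 := by
  rw [minVecsTwo, card_image_signedVec (by norm_num) _ _ fun D s hs =>
    Finset.mem_powerset.1 (Finset.mem_filter.1 hs).1, Finset.sum_congr rfl (g := fun _ => 128)]
  · rw [Finset.sum_const, card_golayCode_octads]
    rfl
  · intro D hD
    have hD := (Finset.mem_filter.1 hD).2
    have := card_filter_even_powerset (Finset.card_pos.1 (by omega : 0 < D.card))
    rw [hD] at this
    omega

lemma card_minVecsOdd : minVecsOdd.card = 98304 := by
  rw [minVecsOdd, Finset.card_image_of_injOn, Finset.card_product, card_golayCode]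
  · rfl
  · rintro ⟨j, s⟩ - ⟨j', s'⟩ - he
    obtain ⟨rfl, rfl⟩ := oddVec_injective he
    rfl

lemma odd_oddVec (j i : Fin 24) (s : Finset (Fin 24)) : Odd (oddVec j s i) := by
  unfold oddVec; split_ifs <;> decide

lemma even_signedVec {k : ℤ} (hk : Even k) (D s : Finset (Fin 24)) (i : Fin 24) :
    Even (signedVec k D s i) := by
  unfold signedVec; split_ifs <;> simp [hk]

/-- The minimal vectors of the Leech lattice, scaled by `√8`. -/
def leechMinVecs : Finset (Fin 24 → ℤ) := (minVecsFour ∪ minVecsTwo) ∪ minVecsOdd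

attribute [irreducible] leechMinVecs

lemma card_leechMinVecs : leechMinVecs.card = 196560 := by
  rw [leechMinVecs, Finset.card_union_of_disjoint, Finset.card_union_of_disjoint,
    card_minVecsFour, card_minVecsTwo, card_minVecsOdd]
  · refine Finset.disjoint_left.2 fun v h4 h2 => ?_
    obtain ⟨D, s, -, -, rfl⟩ := mem_minVecsFour.1 h4
    obtain ⟨D', s', -, hD', -, -, he⟩ := mem_minVecsTwo.1 h2
    obtain ⟨i, hi⟩ := Finset.card_pos.1 (by omega : 0 < D'.card)
    have := congrFun he i
    simp only [signedVec, hi, if_true] at this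
    split_ifs at this <;> omega
  · refine Finset.disjoint_left.2 fun v h h1 => ?_
    obtain ⟨j, s, -, rfl⟩ := mem_minVecsOdd.1 h1
    refine Int.not_even_iff_odd.2 (odd_oddVec j j s) ?_
    rcases Finset.mem_union.1 h with h | h
    · obtain ⟨D, s, -, -, he⟩ := mem_minVecsFour.1 h
      exact he ▸ even_signedVec (by decide) _ _ _
    · obtain ⟨D, s, -, -, -, -, he⟩ := mem_minVecsTwo.1 h
      exact he ▸ even_signedVec (by decide) _ _ _

lemma isLeech_of_mem_leechMinVecs {v : Fin 24 → ℤ} (hv : v ∈ leechMinVecs) : IsLeech v := by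
  rw [leechMinVecs, Finset.mem_union, Finset.mem_union] at hv
  rcases hv with (h | h) | h
  · obtain ⟨D, s, hD, hs, rfl⟩ := mem_minVecsFour.1 h
    exact isLeech_signedVec_four hD hs
  · obtain ⟨D, s, hD, hc, hs, he, rfl⟩ := mem_minVecsTwo.1 h
    exact isLeech_signedVec_two hD hc hs he
  · obtain ⟨j, s, hs, rfl⟩ := mem_minVecsOdd.1 h
    exact isLeech_oddVec j hs

lemma sum_sq_of_mem_leechMinVecs {v : Fin 24 → ℤ} (hv : v ∈ leechMinVecs) :
    ∑ i, v i ^ 2 = 32 := by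
  rw [leechMinVecs, Finset.mem_union, Finset.mem_union] at hv
  rcases hv with (h | h) | h
  · obtain ⟨D, s, hD, hs, rfl⟩ := mem_minVecsFour.1 h
    rw [sum_sq_signedVec, hD]; norm_num
  · obtain ⟨D, s, hD, hc, hs, he, rfl⟩ := mem_minVecsTwo.1 h
    rw [sum_sq_signedVec, hc]; norm_num
  · obtain ⟨j, s, hs, rfl⟩ := mem_minVecsOdd.1 h
    exact sum_sq_oddVec j s

/-- The point `v / √8` of Euclidean space. -/
noncomputable def leechPoint (v : Fin 24 → ℤ) : EuclideanSpace ℝ (Fin 24) :=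
  WithLp.toLp 2 fun i => (v i : ℝ) / √8

lemma leechPoint_apply (v : Fin 24 → ℤ) (i : Fin 24) : leechPoint v i = (v i : ℝ) / √8 := rfl

lemma norm_sq_leechPoint (v : Fin 24 → ℤ) : ‖leechPoint v‖ ^ 2 = ((∑ i, v i ^ 2 : ℤ) : ℝ) / 8 := by
  rw [EuclideanSpace.real_norm_sq_eq]
  simp only [leechPoint_apply, div_pow, ← Finset.sum_div]
  rw [Real.sq_sqrt (by norm_num)]
  push_cast
  rfl

lemma leechPoint_sub (v w : Fin 24 → ℤ) : leechPoint v - leechPoint w = leechPoint (v - w) := by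
  ext i
  simp [leechPoint_apply, sub_div]

lemma two_le_dist_leechPoint {v w : Fin 24 → ℤ} (hv : IsLeech v) (hw : IsLeech w) (h : v ≠ w) :
    2 ≤ dist (leechPoint v) (leechPoint w) := by
  rw [dist_eq_norm, leechPoint_sub]
  refine (sq_le_sq₀ (by norm_num) (norm_nonneg _)).1 ?_
  rw [norm_sq_leechPoint]
  have : ((32 : ℤ) : ℝ) ≤ ((∑ i, (v - w) i ^ 2 : ℤ) : ℝ) :=
    Int.cast_le.2 ((hv.sub hw).min_norm (sub_ne_zero.2 h))
  norm_num at this ⊢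
  linarith

lemma leechPoint_injective : Function.Injective leechPoint := fun v w h => by
  ext i
  have := congrArg (fun x : EuclideanSpace ℝ (Fin 24) => x i) h
  simp only [leechPoint_apply] at this
  exact_mod_cast (div_left_inj' (by positivity : √(8 : ℝ) ≠ 0)).1 this

theorem exists_kissing_configuration : ∃ S : Finset (EuclideanSpace ℝ (Fin 24)),
    (∀ x ∈ S, ‖x‖ = 2) ∧ (∀ x ∈ S, ∀ y ∈ S, x ≠ y → 2 ≤ dist x y) ∧ S.card = 196560 := by
  refine ⟨leechMinVecs.map ⟨leechPoint, leechPoint_injective⟩, ?_, ?_, ?_⟩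
  · simp only [Finset.forall_mem_map, Function.Embedding.coeFn_mk]
    intro v hv
    have := norm_sq_leechPoint v
    rw [sum_sq_of_mem_leechMinVecs hv] at this
    refine (sq_eq_sq₀ (norm_nonneg _) (by norm_num)).1 ?_
    rw [this]
    norm_num
  · simp only [Finset.forall_mem_map, Function.Embedding.coeFn_mk]
    intro v hv w hw hne
    exact two_le_dist_leechPoint (isLeech_of_mem_leechMinVecs hv) (isLeech_of_mem_leechMinVecs hw)
      fun h => hne (h ▸ rfl)
  · rw [Finset.card_map, card_leechMinVecs]

end Leech

theorem kissingNumber_dim24 :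
    (∀ S : Finset (EuclideanSpace ℝ (Fin 24)),
        (∀ x ∈ S, ‖x‖ = 2) →
        (∀ x ∈ S, ∀ y ∈ S, x ≠ y → 2 ≤ dist x y) →
        S.card ≤ 196560) ∧
      ∃ S : Finset (EuclideanSpace ℝ (Fin 24)),
        (∀ x ∈ S, ‖x‖ = 2) ∧
        (∀ x ∈ S, ∀ y ∈ S, x ≠ y → 2 ≤ dist x y) ∧
        S.card = 196560 :=
  ⟨card_le_of_kissing, exists_kissing_configuration⟩
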